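/- (Performance difference bound, upper form.) With T_{π,f}(π') and ε_f^{π'} as defined from an arbitrary bounded f : S → ℝ, J(π') − J(π) ≤ (1/(1−γ)) ( T_{π,f}(π') + 2 ε_f^{π'} D_TV(d^{π'} ∥ d^π) ), and both the lower and upper bounds are tight in the sense that when π' = π both sides are zero. -/

import Mathlib

open Finset

/-- ℙ(s_t = s | π, ρ0, P): time-indexed state distribution of a finite MDP. -/
noncomputable def visit {S A : Type*} [Fintype S] [Fintype A]
    (ρ0 : S → ℝ) (π : S → A → ℝ) (P : S → A → S → ℝ) : ℕ → S → ℝ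
  | 0 => ρ0
  | (t + 1) => fun s' => ∑ s, ∑ a, visit ρ0 π P t s * π s a * P s a s'

/-- Discounted future state distribution d^π(s) = (1−γ) Σ_t γ^t ℙ(s_t = s | π). -/
noncomputable def dvisit {S A : Type*} [Fintype S] [Fintype A]
    (ρ0 : S → ℝ) (π : S → A → ℝ) (P : S → A → S → ℝ) (γ : ℝ) (s : S) : ℝ :=
  (1 - γ) * ∑' t : ℕ, γ ^ t * visit ρ0 π P t s

/-- Expected discounted return J(π) = E_τ[Σ_t γ^t R(s_t,a_t)]. -/
noncomputable def Jret {S A : Type*} [Fintype S] [Fintype A]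
    (ρ0 : S → ℝ) (π : S → A → ℝ) (P : S → A → S → ℝ) (R : S → A → ℝ) (γ : ℝ) : ℝ :=
  ∑' t : ℕ, γ ^ t * ∑ s, ∑ a, visit ρ0 π P t s * π s a * R s a

section Occupancy

variable {S A : Type*} [Fintype S] [Fintype A]
  {ρ0 : S → ℝ} {π : S → A → ℝ} {P : S → A → S → ℝ} {γ : ℝ}

lemma visit_nonneg (hρ0 : ∀ s, 0 ≤ ρ0 s) (hπ0 : ∀ s a, 0 ≤ π s a)
    (hP0 : ∀ s a s', 0 ≤ P s a s') (t : ℕ) (s : S) : 0 ≤ visit ρ0 π P t s := by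
  induction t generalizing s with
  | zero => exact hρ0 s
  | succ t ih =>
    exact sum_nonneg fun x _ => sum_nonneg fun a _ =>
      mul_nonneg (mul_nonneg (ih x) (hπ0 x a)) (hP0 x a s)

lemma sum_visit (hρ1 : ∑ s, ρ0 s = 1) (hπ1 : ∀ s, ∑ a, π s a = 1)
    (hP1 : ∀ s a, ∑ s', P s a s' = 1) (t : ℕ) : ∑ s, visit ρ0 π P t s = 1 := by
  induction t with
  | zero => exact hρ1
  | succ t ih =>
    simp only [visit]
    rw [sum_comm, ← ih]
    refine sum_congr rfl fun s _ => ?_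
    rw [sum_comm]
    simp only [← mul_sum, hP1, hπ1, mul_one]

lemma summable_discounted_visit (hγ0 : 0 ≤ γ) (hγ1 : γ < 1)
    (hρ0 : ∀ s, 0 ≤ ρ0 s) (hρ1 : ∑ s, ρ0 s = 1)
    (hπ0 : ∀ s a, 0 ≤ π s a) (hπ1 : ∀ s, ∑ a, π s a = 1)
    (hP0 : ∀ s a s', 0 ≤ P s a s') (hP1 : ∀ s a, ∑ s', P s a s' = 1) (s : S) :
    Summable fun t : ℕ => γ ^ t * visit ρ0 π P t s := by
  refine (summable_geometric_of_lt_one hγ0 hγ1).of_nonneg_of_le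
    (fun t => mul_nonneg (pow_nonneg hγ0 t) (visit_nonneg hρ0 hπ0 hP0 t s)) fun t => ?_
  refine mul_le_of_le_one_right (pow_nonneg hγ0 t) ?_
  rw [← sum_visit (ρ0 := ρ0) hρ1 hπ1 hP1 t]
  exact single_le_sum (fun x _ => visit_nonneg hρ0 hπ0 hP0 t x) (mem_univ s)

/-- The flow equation of the unnormalised discounted occupancy measure. -/
lemma tsum_visit_flow (hs : ∀ s, Summable fun t : ℕ => γ ^ t * visit ρ0 π P t s) (s' : S) :
    ∑' t : ℕ, γ ^ t * visit ρ0 π P t s' =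
      ρ0 s' + γ * ∑ s, (∑' t : ℕ, γ ^ t * visit ρ0 π P t s) * ∑ a, π s a * P s a s' := by
  rw [(hs s').tsum_eq_zero_add]
  have h : HasSum (fun t : ℕ => γ * ∑ s, (γ ^ t * visit ρ0 π P t s) * ∑ a, π s a * P s a s')
      (γ * ∑ s, (∑' t : ℕ, γ ^ t * visit ρ0 π P t s) * ∑ a, π s a * P s a s') :=
    (hasSum_sum fun s _ => (hs s).hasSum.mul_right _).mul_left γ
  rw [← h.tsum_eq]
  simp only [visit, pow_zero, one_mul, pow_succ, mul_sum]
  congr 1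
  refine tsum_congr fun t => sum_congr rfl fun s _ => sum_congr rfl fun a _ => ?_
  ring

lemma Jret_eq_sum (R : S → A → ℝ)
    (hs : ∀ s, Summable fun t : ℕ => γ ^ t * visit ρ0 π P t s) :
    Jret ρ0 π P R γ = ∑ s, (∑' t : ℕ, γ ^ t * visit ρ0 π P t s) * ∑ a, π s a * R s a := by
  have h : HasSum (fun t : ℕ => ∑ s, (γ ^ t * visit ρ0 π P t s) * ∑ a, π s a * R s a)
      (∑ s, (∑' t : ℕ, γ ^ t * visit ρ0 π P t s) * ∑ a, π s a * R s a) :=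
    hasSum_sum fun s _ => (hs s).hasSum.mul_right _
  rw [← h.tsum_eq, Jret]
  simp only [mul_sum, mul_assoc]

/-- The return expressed through the expected temporal-difference errors of `f`. -/
lemma one_sub_mul_Jret (R : S → A → ℝ) (f : S → ℝ)
    (hs : ∀ s, Summable fun t : ℕ => γ ^ t * visit ρ0 π P t s)
    (hπ1 : ∀ s, ∑ a, π s a = 1) (hP1 : ∀ s a, ∑ s', P s a s' = 1) :
    (1 - γ) * Jret ρ0 π P R γ = (1 - γ) * ∑ s, ρ0 s * f s +
      ∑ s, dvisit ρ0 π P γ s *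
        ∑ a, π s a * ∑ s', P s a s' * (R s a + γ * f s' - f s) := by
  have hflow := tsum_visit_flow hs
  rw [Jret_eq_sum R hs]
  simp only [dvisit]
  set D : S → ℝ := fun s => ∑' t : ℕ, γ ^ t * visit ρ0 π P t s
  have hδ (s : S) : ∑ a, π s a * ∑ s', P s a s' * (R s a + γ * f s' - f s) =
      ∑ a, π s a * R s a + γ * ∑ s', (∑ a, π s a * P s a s') * f s' - f s := by
    have h1 (a : A) : π s a * ∑ s', P s a s' * (R s a + γ * f s' - f s) =
        π s a * R s a + γ * ∑ s', π s a * P s a s' * f s' - π s a * f s := by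
      simp only [mul_add, mul_sub, sum_add_distrib, sum_sub_distrib, ← sum_mul, hP1, one_mul]
      simp only [mul_sum]
      congr 2
      exact sum_congr rfl fun s' _ => by ring
    simp only [h1, sum_add_distrib, sum_sub_distrib, ← sum_mul, hπ1, one_mul]
    rw [← mul_sum, sum_comm]
    simp only [sum_mul]
  have hf : ∑ s, D s * f s = ∑ s, ρ0 s * f s +
      γ * ∑ s, D s * ∑ s', (∑ a, π s a * P s a s') * f s' := by
    calc ∑ s', D s' * f s'
        = ∑ s', (ρ0 s' + γ * ∑ s, D s * ∑ a, π s a * P s a s') * f s' :=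
          sum_congr rfl fun s' _ => by rw [← hflow s']
      _ = _ := by
        simp only [add_mul, sum_add_distrib, mul_assoc, ← mul_sum, sum_mul]
        rw [sum_comm]
        simp only [mul_sum]
  have key : ∑ s, D s * ∑ a, π s a * ∑ s', P s a s' * (R s a + γ * f s' - f s) =
      ∑ s, D s * ∑ a, π s a * R s a - ∑ s, ρ0 s * f s := by
    simp only [hδ]
    simp only [mul_add, mul_sub, sum_add_distrib, sum_sub_distrib]
    rw [hf]
    simp only [mul_left_comm _ γ, ← mul_sum]
    ring
  simp only [mul_assoc (1 - γ), ← mul_sum univ _ (1 - γ)]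
  rw [key]
  ring

end Occupancy

/-- Performance difference bound, upper form (with tightness at π' = π):
J(π') − J(π) ≥ (1/(1−γ)) ( T_{π,f}(π') − 2 ε_f^{π'} D_TV(d^{π'}∥d^π) ). -/
theorem performance_difference_upper_bound {S A : Type*} [Fintype S] [Fintype A] [Nonempty S]
    (ρ0 : S → ℝ) (π π' : S → A → ℝ) (P : S → A → S → ℝ) (R : S → A → ℝ)
    (γ : ℝ) (f : S → ℝ)
    (hγ0 : 0 ≤ γ) (hγ1 : γ < 1)
    (hρ0 : ∀ s, 0 ≤ ρ0 s) (hρ1 : ∑ s, ρ0 s = 1)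
    (hπ0 : ∀ s a, 0 ≤ π s a) (hπ1 : ∀ s, ∑ a, π s a = 1)
    (hπ'0 : ∀ s a, 0 ≤ π' s a) (hπ'1 : ∀ s, ∑ a, π' s a = 1)
    (hP0 : ∀ s a s', 0 ≤ P s a s') (hP1 : ∀ s a, ∑ s', P s a s' = 1)
    (hsupp : ∀ s a, 0 < π' s a → 0 < π s a) :
    Jret ρ0 π' P R γ - Jret ρ0 π P R γ
      ≤ (1 / (1 - γ)) *
        ((∑ s, dvisit ρ0 π P γ s * ∑ a, π s a * ∑ s', P s a s' *
            ((π' s a / π s a - 1) * (R s a + γ * f s' - f s)))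
          + 2 * (⨆ s, |∑ a, π' s a * ∑ s', P s a s' * (R s a + γ * f s' - f s)|) *
            ((1 / 2) * ∑ s, |dvisit ρ0 π' P γ s - dvisit ρ0 π P γ s|)) ∧
    (π' = π →
      Jret ρ0 π' P R γ - Jret ρ0 π P R γ = 0 ∧
      (1 / (1 - γ)) *
        ((∑ s, dvisit ρ0 π P γ s * ∑ a, π s a * ∑ s', P s a s' *
            ((π' s a / π s a - 1) * (R s a + γ * f s' - f s)))
          + 2 * (⨆ s, |∑ a, π' s a * ∑ s', P s a s' * (R s a + γ * f s' - f s)|) *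
            ((1 / 2) * ∑ s, |dvisit ρ0 π' P γ s - dvisit ρ0 π P γ s|)) = 0) := by
  have hγ : 0 < 1 - γ := sub_pos.mpr hγ1
  have hratio (s : S) (a : A) : π s a * (π' s a / π s a - 1) = π' s a - π s a := by
    rcases (hπ0 s a).eq_or_lt with h | h
    · have h' : π' s a = 0 :=
        le_antisymm (not_lt.mp fun hlt => (hsupp s a hlt).ne h) (hπ'0 s a)
      simp [← h, h']
    · field_simp
  have hT (s : S) : ∑ a, π s a * ∑ s', P s a s' *
        ((π' s a / π s a - 1) * (R s a + γ * f s' - f s)) =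
      ∑ a, π' s a * ∑ s', P s a s' * (R s a + γ * f s' - f s) -
        ∑ a, π s a * ∑ s', P s a s' * (R s a + γ * f s' - f s) := by
    rw [← sum_sub_distrib]
    refine sum_congr rfl fun a _ => ?_
    rw [← sub_mul, ← hratio, mul_assoc, mul_sum univ _ (π' s a / π s a - 1)]
    exact congrArg _ (sum_congr rfl fun s' _ => by ring)
  have hJ := one_sub_mul_Jret R f
    (summable_discounted_visit hγ0 hγ1 hρ0 hρ1 hπ0 hπ1 hP0 hP1) hπ1 hP1
  have hJ' := one_sub_mul_Jret R f
    (summable_discounted_visit hγ0 hγ1 hρ0 hρ1 hπ'0 hπ'1 hP0 hP1) hπ'1 hP1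
  simp only [hT]
  refine ⟨?_, ?_⟩
  · set δ : S → ℝ := fun s => ∑ a, π s a * ∑ s', P s a s' * (R s a + γ * f s' - f s)
    set δ' : S → ℝ := fun s => ∑ a, π' s a * ∑ s', P s a s' * (R s a + γ * f s' - f s)
    set d : S → ℝ := dvisit ρ0 π P γ
    set d' : S → ℝ := dvisit ρ0 π' P γ
    have hbound : ∑ s, (d' s - d s) * δ' s ≤ (⨆ s, |δ' s|) * ∑ s, |d' s - d s| := by
      rw [mul_sum]
      refine sum_le_sum fun s _ => (le_abs_self _).trans ?_
      rw [abs_mul, mul_comm]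
      exact mul_le_mul_of_nonneg_right
        (le_ciSup (f := fun s => |δ' s|) (Set.finite_range _).bddAbove s) (abs_nonneg _)
    have hsplit : ∑ s, d' s * δ' s - ∑ s, d s * δ s =
        ∑ s, d s * (δ' s - δ s) + ∑ s, (d' s - d s) * δ' s := by
      rw [← sum_sub_distrib, ← sum_add_distrib]
      exact sum_congr rfl fun s _ => by ring
    rw [one_div_mul_eq_div, le_div_iff₀ hγ]
    linarith
  · rintro rfl
    simp
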